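/- Let q be a primitive ℓ-th root of unity with ℓ > 1 odd. The center of D_q(C^N) is exactly the subalgebra generated by x_1^ℓ,...,x_N^ℓ, ∂_1^ℓ,...,∂_N^ℓ, and this subalgebra is isomorphic to a polynomial algebra in 2N variables. -/

import Mathlib

noncomputable section

/-- Generators of the quantum Weyl algebra D_q(ℂ^N). -/
inductive DGen (N : ℕ) : Type
  | x (i : Fin N)
  | p (i : Fin N)

/-- The generator x_i in the free algebra. -/
def Xf (N : ℕ) (i : Fin N) : FreeAlgebra ℂ (DGen N) := FreeAlgebra.ι ℂ (DGen.x i)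

/-- The generator ∂_i in the free algebra. -/
def Pf (N : ℕ) (i : Fin N) : FreeAlgebra ℂ (DGen N) := FreeAlgebra.ι ℂ (DGen.p i)

/-- The defining relations of D_q(ℂ^N). -/
inductive DqRel (q : ℂ) (N : ℕ) : FreeAlgebra ℂ (DGen N) → FreeAlgebra ℂ (DGen N) → Prop
  | xx {i j : Fin N} (h : i < j) : DqRel q N (Xf N j * Xf N i) (q • (Xf N i * Xf N j))
  | pp {i j : Fin N} (h : i < j) : DqRel q N (Pf N j * Pf N i) (q⁻¹ • (Pf N i * Pf N j))
  | px {i j : Fin N} (h : j ≠ i) : DqRel q N (Pf N j * Xf N i) (q • (Xf N i * Pf N j))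
  | pxi (i : Fin N) : DqRel q N (Pf N i * Xf N i)
      (q ^ 2 • (Xf N i * Pf N i) + (q ^ 2 - 1) •
        (1 + ∑ j ∈ Finset.univ.filter (fun j : Fin N => j < i), Xf N j * Pf N j))

/-- The quantum Weyl algebra D_q(ℂ^N), presented by generators and relations. -/
abbrev DqWeyl (q : ℂ) (N : ℕ) := RingQuot (DqRel q N)

/-- The image of x_i in D_q(ℂ^N). -/
def xg (q : ℂ) (N : ℕ) (i : Fin N) : DqWeyl q N := RingQuot.mkAlgHom ℂ (DqRel q N) (Xf N i)

/-- The image of ∂_i in D_q(ℂ^N). -/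
def pg (q : ℂ) (N : ℕ) (i : Fin N) : DqWeyl q N := RingQuot.mkAlgHom ℂ (DqRel q N) (Pf N i)

section PrefixSum

variable {M : Type*} [AddCommMonoid M] {N : ℕ}

/-- The sum of the first `n` entries of a tuple. -/
def prefixSum (g : Fin N → M) (n : ℕ) : M :=
  ∑ j ∈ Finset.univ.filter (fun j : Fin N => (j : ℕ) < n), g j

@[simp]
theorem prefixSum_zero (g : Fin N → M) : prefixSum g 0 = 0 := by
  simp [prefixSum]

theorem prefixSum_succ (g : Fin N → M) (i : Fin N) :
    prefixSum g (i + 1) = prefixSum g i + g i := by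
  have : Finset.univ.filter (fun j : Fin N => (j : ℕ) < i + 1) =
      insert i (Finset.univ.filter (fun j : Fin N => (j : ℕ) < i)) := by
    ext j
    simp only [Finset.mem_filter, Finset.mem_univ, true_and, Finset.mem_insert, Fin.ext_iff]
    omega
  rw [prefixSum, this, Finset.sum_insert (by simp), add_comm, prefixSum]

theorem prefixSum_succ_of_le (g : Fin N → M) {n : ℕ} (hn : N ≤ n) :
    prefixSum g (n + 1) = prefixSum g n := by
  unfold prefixSum
  congr 1
  ext j
  have := j.isLt
  simp only [Finset.mem_filter, Finset.mem_univ, true_and]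
  omega

theorem prefixSum_add (g h : Fin N → M) (n : ℕ) :
    prefixSum (g + h) n = prefixSum g n + prefixSum h n := by
  simp [prefixSum, Finset.sum_add_distrib]

theorem prefixSum_sub {M : Type*} [AddCommGroup M] (g h : Fin N → M) (n : ℕ) :
    prefixSum (g - h) n = prefixSum g n - prefixSum h n := by
  simp [prefixSum, Finset.sum_sub_distrib]

theorem prefixSum_single (i : Fin N) (a : M) (n : ℕ) :
    prefixSum (Pi.single i a) n = if (i : ℕ) < n then a else 0 := by
  simp [prefixSum]

end PrefixSum

section CommAeval

variable {σ B : Type*} [Ring B] [Algebra ℂ B]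

open scoped IsMulCommutative in
/-- Evaluation of polynomials at pairwise commuting elements of a noncommutative algebra. -/
def commAeval (t : σ → B) (ht : ∀ i j, Commute (t i) (t j)) : MvPolynomial σ ℂ →ₐ[ℂ] B :=
  haveI : IsMulCommutative (Algebra.adjoin ℂ (Set.range t)) :=
    Algebra.isMulCommutative_adjoin ℂ (by rintro _ ⟨i, rfl⟩ _ ⟨j, rfl⟩; exact ht i j)
  (Algebra.adjoin ℂ (Set.range t)).val.comp
    (MvPolynomial.aeval fun i => ⟨t i, Algebra.subset_adjoin ⟨i, rfl⟩⟩)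

@[simp]
theorem commAeval_X (t : σ → B) (ht : ∀ i j, Commute (t i) (t j)) (i : σ) :
    commAeval t ht (MvPolynomial.X i) = t i := by
  simp [commAeval]

theorem commAeval_range (t : σ → B) (ht : ∀ i j, Commute (t i) (t j)) :
    (commAeval t ht).range = Algebra.adjoin ℂ (Set.range t) := by
  have h := AlgHom.map_adjoin (commAeval t ht) (Set.range (MvPolynomial.X (R := ℂ)))
  rw [MvPolynomial.adjoin_range_X, Algebra.map_top, ← Set.range_comp] at h
  rw [h]
  congr 2
  ext i
  simp

end CommAeval

section SkewCommutation

variable {B : Type*} [Ring B] [Algebra ℂ B]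

theorem skew_pow {a b : B} {c : ℂ} (h : a * b = c • (b * a)) (n : ℕ) :
    a * b ^ n = c ^ n • (b ^ n * a) := by
  induction n with
  | zero => simp
  | succ n ih =>
    rw [pow_succ, ← mul_assoc, ih, smul_mul_assoc, mul_assoc, h, mul_smul_comm, smul_smul,
      ← pow_succ, mul_assoc]

theorem skew_symm {a b : B} {c : ℂ} (hc : c ≠ 0) (h : a * b = c • (b * a)) :
    b * a = c⁻¹ • (a * b) := by
  rw [h, smul_smul, inv_mul_cancel₀ hc, one_smul]

theorem commute_pow_of_skew {a b : B} {c : ℂ} {l : ℕ} (hc : c ^ l = 1)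
    (h : a * b = c • (b * a)) : Commute (b ^ l) a := by
  have := skew_pow h l
  rw [hc, one_smul] at this
  exact this.symm

theorem qWeyl_mul_pow {p x t : B} {c : ℂ} (h : p * x = c • (x * p) + (c - 1) • t)
    (ht : t * x = x * t) (n : ℕ) :
    p * x ^ (n + 1) = c ^ (n + 1) • (x ^ (n + 1) * p) + (c ^ (n + 1) - 1) • (x ^ n * t) := by
  induction n with
  | zero => simpa using h
  | succ n ih =>
    rw [pow_succ x (n + 1), ← mul_assoc, ih, add_mul, smul_mul_assoc, smul_mul_assoc,
      mul_assoc _ p x, h, mul_assoc _ t x, ht, mul_add, ← mul_assoc _ x t, ← pow_succ]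
    simp only [mul_smul_comm, ← mul_assoc, ← pow_succ]
    module

theorem qWeyl_pow_mul {p x t : B} {c : ℂ} (h : p * x = c • (x * p) + (c - 1) • t)
    (ht : p * t = t * p) (n : ℕ) :
    p ^ (n + 1) * x = c ^ (n + 1) • (x * p ^ (n + 1)) + (c ^ (n + 1) - 1) • (t * p ^ n) := by
  induction n with
  | zero => simpa using h
  | succ n ih =>
    rw [pow_succ' p (n + 1), mul_assoc, ih, mul_add, mul_smul_comm, mul_smul_comm,
      ← mul_assoc p x, h, ← mul_assoc p t, ht, add_mul, mul_assoc t p, ← pow_succ']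
    simp only [smul_mul_assoc, mul_assoc, ← pow_succ']
    module

theorem prod_root_mul_sub {ζ : ℂ} {l : ℕ} (hodd : Odd l) (hζ : IsPrimitiveRoot ζ l)
    {K : Type*} [CommRing K] [IsDomain K] [Algebra ℂ K] (a b : K) :
    ∏ s ∈ Finset.range l, (ζ ^ s • a - b) = a ^ l - b ^ l := by
  have hinj : Function.Injective (algebraMap ℂ K) := (algebraMap ℂ K).injective
  have hK := hζ.map_of_injective hinj
  have h := hK.pow_sub_pow_eq_prod_sub_mul b a hodd.pos
  have hprod : ∏ ξ ∈ Polynomial.nthRootsFinset l (1 : K), (b - ξ * a) =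
      ∏ s ∈ Finset.range l, (b - ζ ^ s • a) := by
    classical
    rw [Polynomial.nthRootsFinset, ← Multiset.toFinset_eq hK.nthRoots_one_nodup,
      Finset.prod_mk, hK.nthRoots_eq (one_pow l), Multiset.map_map, Finset.prod]
    simp [Algebra.smul_def]
  rw [hprod] at h
  rw [← neg_sub (b ^ l), h, Finset.prod_congr rfl fun s _ => (neg_sub b (ζ ^ s • a)).symm,
    Finset.prod_neg, Finset.card_range, hodd.neg_one_pow, neg_one_mul]

end SkewCommutation

section Relations

variable {q : ℂ} {N : ℕ}

theorem xg_mul_xg {i j : Fin N} (h : i < j) :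
    xg q N j * xg q N i = q • (xg q N i * xg q N j) := by
  simpa [xg] using RingQuot.mkAlgHom_rel ℂ (DqRel.xx (q := q) h)

theorem pg_mul_pg {i j : Fin N} (h : i < j) :
    pg q N j * pg q N i = q⁻¹ • (pg q N i * pg q N j) := by
  simpa [pg] using RingQuot.mkAlgHom_rel ℂ (DqRel.pp (q := q) h)

theorem pg_mul_xg {i j : Fin N} (h : j ≠ i) :
    pg q N j * xg q N i = q • (xg q N i * pg q N j) := by
  simpa [xg, pg] using RingQuot.mkAlgHom_rel ℂ (DqRel.px (q := q) h)

variable (q N) in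
/-- The element `1 + x_0 ∂_0 + ⋯ + x_{n-1} ∂_{n-1}`. -/
def tg (n : ℕ) : DqWeyl q N := 1 + prefixSum (fun j => xg q N j * pg q N j) n

@[simp]
theorem tg_zero : tg q N 0 = 1 := by simp [tg]

theorem tg_succ (i : Fin N) : tg q N (i + 1) = tg q N i + xg q N i * pg q N i := by
  rw [tg, tg, prefixSum_succ, add_assoc]

theorem tg_succ_of_le {n : ℕ} (hn : N ≤ n) : tg q N (n + 1) = tg q N n := by
  rw [tg, tg, prefixSum_succ_of_le _ hn]

theorem pg_mul_xg_self (i : Fin N) :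
    pg q N i * xg q N i = q ^ 2 • (xg q N i * pg q N i) + (q ^ 2 - 1) • tg q N i := by
  simpa [xg, pg, tg, prefixSum] using RingQuot.mkAlgHom_rel ℂ (DqRel.pxi (q := q) i)

/-- Induction on `n` for statements about `tg q N n`. -/
theorem tg_induction {P : ℕ → DqWeyl q N → Prop} (zero : P 0 1)
    (succ : ∀ i : Fin N, P i (tg q N i) → P (i + 1) (tg q N i + xg q N i * pg q N i))
    (const : ∀ n, N ≤ n → P n (tg q N n) → P (n + 1) (tg q N n)) (n : ℕ) : P n (tg q N n) := by
  induction n with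
  | zero => simpa using zero
  | succ n ih =>
    by_cases h : n < N
    · have := succ ⟨n, h⟩ ih
      rwa [← tg_succ] at this
    · rw [tg_succ_of_le (not_lt.1 h)]
      exact const n (not_lt.1 h) ih

theorem tg_mul_xg (hq : q ≠ 0) (n : ℕ) (j : Fin N) :
    tg q N n * xg q N j = (if (j : ℕ) < n then q ^ 2 else 1) • (xg q N j * tg q N n) := by
  refine tg_induction (P := fun n t => t * xg q N j =
    (if (j : ℕ) < n then q ^ 2 else 1) • (xg q N j * t)) (by simp) (fun i ih => ?_)
    (fun n hn ih => ?_) n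
  · rw [add_mul, mul_add, ih, mul_assoc]
    rcases lt_trichotomy i j with h | rfl | h
    · rw [pg_mul_xg h.ne, mul_smul_comm, ← mul_assoc, skew_symm hq (xg_mul_xg h)]
      have h1 : ¬ (j : ℕ) < i := by omega
      have h2 : ¬ (j : ℕ) < i + 1 := by omega
      simp [h1, h2, smul_smul, hq, mul_assoc]
    · rw [pg_mul_xg_self, if_neg (lt_irrefl _), if_pos (Nat.lt_succ_self _)]
      simp only [mul_add, mul_smul_comm]
      module
    · rw [pg_mul_xg h.ne', mul_smul_comm, ← mul_assoc, xg_mul_xg h]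
      have h1 : (j : ℕ) < i := h
      have h2 : (j : ℕ) < i + 1 := by omega
      simp [h1, h2, smul_smul, mul_assoc, ← pow_two]
  · have h1 : (j : ℕ) < n := by omega
    rw [if_pos h1] at ih
    rw [ih, if_pos (by omega)]

theorem pg_mul_tg (hq : q ≠ 0) (n : ℕ) (j : Fin N) :
    pg q N j * tg q N n = (if (j : ℕ) < n then q ^ 2 else 1) • (tg q N n * pg q N j) := by
  refine tg_induction (P := fun n t => pg q N j * t =
    (if (j : ℕ) < n then q ^ 2 else 1) • (t * pg q N j)) (by simp) (fun i ih => ?_)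
    (fun n hn ih => ?_) n
  · rw [add_mul, mul_add, ih, ← mul_assoc]
    rcases lt_trichotomy i j with h | rfl | h
    · rw [pg_mul_xg h.ne', smul_mul_assoc, mul_assoc, pg_mul_pg h]
      have h1 : ¬ (j : ℕ) < i := by omega
      have h2 : ¬ (j : ℕ) < i + 1 := by omega
      simp [h1, h2, smul_smul, hq, mul_assoc]
    · rw [pg_mul_xg_self, if_neg (lt_irrefl _), if_pos (Nat.lt_succ_self _)]
      simp only [add_mul, smul_mul_assoc]
      module
    · rw [pg_mul_xg h.ne, smul_mul_assoc, mul_assoc,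
        skew_symm (inv_ne_zero hq) (pg_mul_pg h)]
      have h1 : (j : ℕ) < i := h
      have h2 : (j : ℕ) < i + 1 := by omega
      simp [h1, h2, smul_smul, mul_assoc, ← pow_two]
  · have h1 : (j : ℕ) < n := by omega
    rw [if_pos h1] at ih
    rw [ih, if_pos (by omega)]

theorem tg_commute (hq : q ≠ 0) (m n : ℕ) : Commute (tg q N m) (tg q N n) := by
  refine tg_induction (P := fun _ t => Commute (tg q N m) t) (Commute.one_right _)
    (fun i ih => ih.add_right ?_) (fun n _ ih => ih) n
  rw [Commute, SemiconjBy, ← mul_assoc, tg_mul_xg hq, smul_mul_assoc, mul_assoc, mul_assoc,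
    pg_mul_tg hq, mul_smul_comm]

theorem mem_of_gens {S : Submodule ℂ (DqWeyl q N)} (h1 : 1 ∈ S)
    (hx : ∀ i, ∀ s ∈ S, xg q N i * s ∈ S) (hp : ∀ i, ∀ s ∈ S, pg q N i * s ∈ S)
    (d : DqWeyl q N) : d ∈ S := by
  obtain ⟨a, rfl⟩ := RingQuot.mkAlgHom_surjective ℂ (DqRel q N) d
  suffices ∀ s ∈ S, RingQuot.mkAlgHom ℂ (DqRel q N) a * s ∈ S by simpa using this 1 h1
  induction a using FreeAlgebra.induction with
  | grade0 r =>
    intro s hs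
    rw [AlgHom.commutes, ← Algebra.smul_def]
    exact S.smul_mem r hs
  | grade1 g =>
    intro s hs
    cases g with
    | x i => exact hx i s hs
    | p i => exact hp i s hs
  | mul a b ha hb =>
    intro s hs
    rw [map_mul, mul_assoc]
    exact ha _ (hb _ hs)
  | add a b ha hb =>
    intro s hs
    rw [map_add, add_mul]
    exact S.add_mem (ha _ hs) (hb _ hs)

theorem mem_center_of_commute {z : DqWeyl q N} (hx : ∀ i, Commute z (xg q N i))
    (hp : ∀ i, Commute z (pg q N i)) : z ∈ Subalgebra.center ℂ (DqWeyl q N) := by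
  rw [Subalgebra.mem_center_iff]
  intro d
  have hmem : ∀ g : DqWeyl q N, Commute z g → g ∈ Subalgebra.centralizer ℂ {z} :=
    fun g hg => by simpa [Subalgebra.mem_centralizer_iff] using hg.eq
  have hd : d ∈ Subalgebra.toSubmodule (Subalgebra.centralizer ℂ {z}) :=
    mem_of_gens (one_mem (Subalgebra.centralizer ℂ {z}))
      (fun i _ hs => (Subalgebra.centralizer ℂ {z}).mul_mem (hmem _ (hx i)) hs)
      (fun i _ hs => (Subalgebra.centralizer ℂ {z}).mul_mem (hmem _ (hp i)) hs) d
  exact (Subalgebra.mem_centralizer_iff ℂ |>.1 hd z rfl).symm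

theorem xg_pow_mem_center {l : ℕ} (hl : 0 < l) (hql : q ^ l = 1) (i : Fin N) :
    xg q N i ^ l ∈ Subalgebra.center ℂ (DqWeyl q N) := by
  have hq : q ≠ 0 := fun h => by simp [h, hl.ne'] at hql
  refine mem_center_of_commute (fun j => ?_) (fun j => ?_)
  · rcases lt_trichotomy i j with h | rfl | h
    · exact commute_pow_of_skew hql (xg_mul_xg h)
    · exact (Commute.refl _).pow_left _
    · exact commute_pow_of_skew (by rw [inv_pow, hql, inv_one]) (skew_symm hq (xg_mul_xg h))
  · rcases eq_or_ne j i with rfl | h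
    · obtain ⟨n, rfl⟩ : ∃ n, l = n + 1 := ⟨l - 1, by omega⟩
      have hc : (q ^ 2) ^ (n + 1) = 1 := by rw [← pow_mul, mul_comm, pow_mul, hql, one_pow]
      have := qWeyl_mul_pow (pg_mul_xg_self j) (by simpa using tg_mul_xg hq j j) n
      rw [hc, sub_self, zero_smul, add_zero, one_smul] at this
      exact this.symm
    · exact commute_pow_of_skew hql (pg_mul_xg h)

theorem pg_pow_mem_center {l : ℕ} (hl : 0 < l) (hql : q ^ l = 1) (i : Fin N) :
    pg q N i ^ l ∈ Subalgebra.center ℂ (DqWeyl q N) := by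
  have hq : q ≠ 0 := fun h => by simp [h, hl.ne'] at hql
  have hql' : q⁻¹ ^ l = 1 := by rw [inv_pow, hql, inv_one]
  refine mem_center_of_commute (fun j => ?_) (fun j => ?_)
  · rcases eq_or_ne i j with rfl | h
    · obtain ⟨n, rfl⟩ : ∃ n, l = n + 1 := ⟨l - 1, by omega⟩
      have hc : (q ^ 2) ^ (n + 1) = 1 := by rw [← pow_mul, mul_comm, pow_mul, hql, one_pow]
      have := qWeyl_pow_mul (pg_mul_xg_self i) (by simpa using pg_mul_tg hq i i) n
      rw [hc, sub_self, zero_smul, add_zero, one_smul] at this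
      exact this
    · exact commute_pow_of_skew hql' (skew_symm hq (pg_mul_xg h))
  · rcases lt_trichotomy i j with h | rfl | h
    · exact commute_pow_of_skew hql' (pg_mul_pg h)
    · exact (Commute.refl _).pow_left _
    · exact commute_pow_of_skew (by simp [hql]) (skew_symm (inv_ne_zero hq) (pg_mul_pg h))

theorem xg_pow_mul_pg_pow (hq : q ≠ 0) {l : ℕ} (hodd : Odd l) (hql : IsPrimitiveRoot q l)
    (i : Fin N) : xg q N i ^ l * pg q N i ^ l = tg q N (i + 1) ^ l - tg q N i ^ l := by
  set ζ := (q ^ 2)⁻¹ with hζ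
  have hζl : IsPrimitiveRoot ζ l :=
    (hql.pow_of_coprime 2 hodd.coprime_two_left).inv
  have hcomm : ∀ a b : Fin 2, Commute (![tg q N (i + 1), tg q N i] a)
      (![tg q N (i + 1), tg q N i] b) := by
    intro a b
    fin_cases a <;> fin_cases b <;> exact tg_commute hq _ _
  have key : ∀ n : ℕ, xg q N i ^ n * pg q N i ^ n = commAeval _ hcomm
      (∏ s ∈ Finset.range n, (ζ ^ s • MvPolynomial.X 0 - MvPolynomial.X 1)) := by
    intro n
    induction n with
    | zero => simp
    | succ n ih =>
      have hs : tg q N (i + 1) * xg q N i = q ^ 2 • (xg q N i * tg q N (i + 1)) := by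
        simpa using tg_mul_xg hq (i + 1) i
      have h0 : tg q N i * xg q N i = (1 : ℂ) • (xg q N i * tg q N i) := by
        simpa using tg_mul_xg hq i i
      have hsn := skew_symm (pow_ne_zero n (pow_ne_zero 2 hq)) (skew_pow hs n)
      have h0n := skew_symm (pow_ne_zero n one_ne_zero) (skew_pow h0 n)
      have hxp : xg q N i * pg q N i = tg q N (i + 1) - tg q N i := by
        rw [tg_succ, add_sub_cancel_left]
      rw [Finset.prod_range_succ, mul_comm, map_mul, ← ih, pow_succ, pow_succ',
        mul_assoc, ← mul_assoc (xg q N i), hxp, ← mul_assoc, ← mul_assoc, mul_sub, hsn, h0n]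
      simp [hζ, sub_mul, mul_assoc]
  rw [key, prod_root_mul_sub hodd hζl]
  simp

end Relations

section NormalForm

variable {q : ℂ} {N : ℕ}

/-- Evaluation of polynomials at `tg 1, …, tg N`. -/
def tgAeval (hq : q ≠ 0) (N : ℕ) : MvPolynomial (Fin N) ℂ →ₐ[ℂ] DqWeyl q N :=
  commAeval (fun i => tg q N (i + 1)) fun _ _ => tg_commute hq _ _

@[simp]
theorem tgAeval_X (hq : q ≠ 0) (i : Fin N) :
    tgAeval hq N (MvPolynomial.X i) = tg q N (i + 1) := by
  simp [tgAeval]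

theorem exists_tgAeval_eq_tg (hq : q ≠ 0) (n : ℕ) : ∃ a, tgAeval hq N a = tg q N n := by
  induction n with
  | zero => exact ⟨1, by simp⟩
  | succ n ih =>
    by_cases h : n < N
    · exact ⟨MvPolynomial.X ⟨n, h⟩, by simp⟩
    · rwa [tg_succ_of_le (not_lt.1 h)]

/-- An element past which polynomials in the `tg n` can be moved to the right. -/
def TgNormal (hq : q ≠ 0) (d : DqWeyl q N) : Prop :=
  ∀ a, ∃ b, tgAeval hq N a * d = d * tgAeval hq N b

theorem TgNormal.of_skew {hq : q ≠ 0} {d : DqWeyl q N}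
    (h : ∀ i : Fin N, ∃ c : ℂ, tg q N (i + 1) * d = c • (d * tg q N (i + 1))) :
    TgNormal hq d := by
  intro a
  induction a using MvPolynomial.induction_on with
  | C r =>
    refine ⟨MvPolynomial.C r, ?_⟩
    rw [← MvPolynomial.algebraMap_eq, AlgHom.commutes, Algebra.commutes]
  | add a b ha hb =>
    obtain ⟨a', ha⟩ := ha
    obtain ⟨b', hb⟩ := hb
    exact ⟨a' + b', by rw [map_add, add_mul, ha, hb, map_add, mul_add]⟩
  | mul_X a i ha =>
    obtain ⟨a', ha⟩ := ha
    obtain ⟨c, hc⟩ := h i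
    refine ⟨c • (a' * MvPolynomial.X i), ?_⟩
    rw [map_mul, tgAeval_X, mul_assoc, hc, mul_smul_comm, ← mul_assoc, ha, map_smul, map_mul,
      tgAeval_X, mul_smul_comm, mul_assoc]

theorem TgNormal.one (hq : q ≠ 0) : TgNormal hq (1 : DqWeyl q N) := fun a => ⟨a, by simp⟩

theorem TgNormal.mul {hq : q ≠ 0} {d e : DqWeyl q N} (hd : TgNormal hq d) (he : TgNormal hq e) :
    TgNormal hq (d * e) := by
  intro a
  obtain ⟨b, hb⟩ := hd a
  obtain ⟨c, hc⟩ := he b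
  exact ⟨c, by rw [← mul_assoc, hb, mul_assoc, hc, mul_assoc]⟩

theorem TgNormal.pow {hq : q ≠ 0} {d : DqWeyl q N} (hd : TgNormal hq d) (n : ℕ) :
    TgNormal hq (d ^ n) := by
  induction n with
  | zero => simpa using TgNormal.one hq
  | succ n ih => rw [pow_succ]; exact ih.mul hd

theorem tgNormal_xg (hq : q ≠ 0) (i : Fin N) : TgNormal hq (xg q N i) :=
  .of_skew fun _ => ⟨_, tg_mul_xg hq _ _⟩

theorem tgNormal_pg (hq : q ≠ 0) (i : Fin N) : TgNormal hq (pg q N i) :=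
  .of_skew fun _ => ⟨_, skew_symm (by split_ifs <;> simp [hq]) (pg_mul_tg hq _ _)⟩

variable (q N) in
/-- The power `x_i ^ k` for `0 ≤ k`, and `∂_i ^ (-k)` for `k < 0`. -/
def zPow (i : Fin N) : ℤ → DqWeyl q N
  | .ofNat n => xg q N i ^ n
  | .negSucc n => pg q N i ^ (n + 1)

theorem tgNormal_zPow (hq : q ≠ 0) (i : Fin N) (k : ℤ) : TgNormal hq (zPow q N i k) := by
  cases k with
  | ofNat n => exact (tgNormal_xg hq i).pow n
  | negSucc n => exact (tgNormal_pg hq i).pow (n + 1)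

theorem zPow_neg (i : Fin N) (n : ℕ) : zPow q N i (-n) = pg q N i ^ n := by
  cases n with
  | zero => simp [zPow]
  | succ n => rfl

theorem xg_mul_zPow_self (hq : q ≠ 0) (i : Fin N) (k : ℤ) :
    ∃ a, xg q N i * zPow q N i k = zPow q N i (k + 1) * tgAeval hq N a := by
  cases k with
  | ofNat n => exact ⟨1, by rw [map_one, mul_one]; exact (pow_succ' _ _).symm⟩
  | negSucc n =>
    obtain ⟨a, ha⟩ := exists_tgAeval_eq_tg (N := N) hq (i + 1)
    obtain ⟨b, hb⟩ := exists_tgAeval_eq_tg (N := N) hq i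
    obtain ⟨c, hc⟩ := (tgNormal_pg hq i).pow n (a - b)
    refine ⟨c, ?_⟩
    rw [show Int.negSucc n + 1 = -n by omega, zPow_neg, ← hc, map_sub, ha, hb, tg_succ,
      add_sub_cancel_left, mul_assoc, ← pow_succ']
    rfl

theorem pg_mul_zPow_self (hq : q ≠ 0) (i : Fin N) (k : ℤ) :
    ∃ a, pg q N i * zPow q N i k = zPow q N i (k - 1) * tgAeval hq N a := by
  rcases le_or_gt k 0 with hk | hk
  · obtain ⟨n, rfl⟩ : ∃ n : ℕ, k = -n := ⟨k.natAbs, by omega⟩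
    refine ⟨1, ?_⟩
    rw [zPow_neg, show (-n - 1 : ℤ) = -((n + 1 : ℕ) : ℤ) by omega, zPow_neg, map_one, mul_one,
      pow_succ']
  · obtain ⟨n, rfl⟩ : ∃ n : ℕ, k = n + 1 := ⟨(k - 1).natAbs, by omega⟩
    obtain ⟨a, ha⟩ := exists_tgAeval_eq_tg (N := N) hq (i + 1)
    obtain ⟨b, hb⟩ := exists_tgAeval_eq_tg (N := N) hq i
    obtain ⟨c, hc⟩ := (tgNormal_xg hq i).pow n (q ^ 2 • a - b)
    refine ⟨c, ?_⟩
    have hpx : pg q N i * xg q N i = tgAeval hq N (q ^ 2 • a - b) := by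
      rw [map_sub, map_smul, ha, hb, tg_succ, pg_mul_xg_self]
      module
    rw [add_sub_cancel_right]
    change pg q N i * xg q N i ^ (n + 1) = xg q N i ^ n * _
    rw [← hc, ← hpx, pow_succ', mul_assoc]

theorem xg_mul_zPow_of_ne (hq : q ≠ 0) {i j : Fin N} (h : i ≠ j) (k : ℤ) :
    ∃ c : ℂ, xg q N i * zPow q N j k = c • (zPow q N j k * xg q N i) := by
  cases k with
  | ofNat n =>
    rcases h.lt_or_gt with h | h
    · exact ⟨_, skew_pow (skew_symm hq (xg_mul_xg h)) n⟩
    · exact ⟨_, skew_pow (xg_mul_xg h) n⟩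
  | negSucc n => exact ⟨_, skew_pow (skew_symm hq (pg_mul_xg h.symm)) (n + 1)⟩

theorem pg_mul_zPow_of_ne (hq : q ≠ 0) {i j : Fin N} (h : i ≠ j) (k : ℤ) :
    ∃ c : ℂ, pg q N i * zPow q N j k = c • (zPow q N j k * pg q N i) := by
  cases k with
  | ofNat n => exact ⟨_, skew_pow (pg_mul_xg h) n⟩
  | negSucc n =>
    rcases h.lt_or_gt with h | h
    · exact ⟨_, skew_pow (skew_symm (inv_ne_zero hq) (pg_mul_pg h)) (n + 1)⟩
    · exact ⟨_, skew_pow (pg_mul_pg h) (n + 1)⟩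

variable (q) in
/-- The ordered product of the first `n` factors `zPow q N i (α i)`. -/
def zMonomial (α : Fin N → ℤ) : ℕ → DqWeyl q N
  | 0 => 1
  | n + 1 => zMonomial α n * if h : n < N then zPow q N ⟨n, h⟩ (α ⟨n, h⟩) else 1

theorem zMonomial_succ (α : Fin N → ℤ) (i : Fin N) :
    zMonomial q α (i + 1) = zMonomial q α i * zPow q N i (α i) := by
  rw [zMonomial, dif_pos i.isLt]

theorem zMonomial_congr {α β : Fin N → ℤ} {n : ℕ} (h : ∀ i : Fin N, (i : ℕ) < n → α i = β i) :
    zMonomial q α n = zMonomial q β n := by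
  induction n with
  | zero => rfl
  | succ n ih =>
    rw [zMonomial, zMonomial, ih fun i hi => h i (by omega)]
    split_ifs with hn
    · rw [h ⟨n, hn⟩ (Nat.lt_succ_self n)]
    · rfl

theorem exists_mul_zMonomial {hq : q ≠ 0} {d : DqWeyl q N} {i : Fin N} {e : ℤ}
    (hself : ∀ k, ∃ a, d * zPow q N i k = zPow q N i (k + e) * tgAeval hq N a)
    (hne : ∀ j, i ≠ j → ∀ k, ∃ c : ℂ, d * zPow q N j k = c • (zPow q N j k * d))
    (α : Fin N → ℤ) :
    ∃ a, d * zMonomial q α N = zMonomial q (α + Pi.single i e) N * tgAeval hq N a := by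
  have hlt : ∀ n : ℕ, n ≤ i → ∃ c : ℂ, d * zMonomial q α n = c • (zMonomial q α n * d) := by
    intro n
    induction n with
    | zero => exact fun _ => ⟨1, by simp [zMonomial]⟩
    | succ n ih =>
      intro hn
      obtain ⟨c, hc⟩ := ih (by omega)
      have hnN : n < N := by omega
      obtain ⟨c', hc'⟩ := hne ⟨n, hnN⟩ (by rw [Ne, Fin.ext_iff]; simp; omega) (α ⟨n, hnN⟩)
      refine ⟨c * c', ?_⟩
      rw [zMonomial, dif_pos hnN, ← mul_assoc, hc, smul_mul_assoc, mul_assoc, hc',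
        mul_smul_comm, smul_smul, mul_assoc]
  have hgt : ∀ n : ℕ, (i : ℕ) < n →
      ∃ a, d * zMonomial q α n = zMonomial q (α + Pi.single i e) n * tgAeval hq N a := by
    intro n hn
    induction n, hn using Nat.le_induction with
    | base =>
      obtain ⟨c, hc⟩ := hlt i le_rfl
      obtain ⟨a, ha⟩ := hself (α i)
      refine ⟨c • a, ?_⟩
      rw [Nat.succ_eq_add_one, zMonomial_succ, zMonomial_succ, ← mul_assoc, hc, smul_mul_assoc,
        mul_assoc, ha, zMonomial_congr (β := α + Pi.single i e)]
      · simp [mul_assoc]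
      · intro j hj
        have : j ≠ i := by rintro rfl; omega
        simp [this]
    | succ n hn ih =>
      obtain ⟨a, ha⟩ := ih
      rw [zMonomial, zMonomial, ← mul_assoc, ha, mul_assoc]
      split_ifs with h
      · have : (⟨n, h⟩ : Fin N) ≠ i := by rintro rfl; exact Nat.not_succ_le_self _ hn
        obtain ⟨b, hb⟩ := tgNormal_zPow hq ⟨n, h⟩ (α ⟨n, h⟩) a
        exact ⟨b, by simp [hb, this, mul_assoc]⟩
      · exact ⟨a, by simp⟩
  exact hgt N i.isLt

/-- The map sending a family of polynomials `f α` to `∑ zMonomial α * f α (tg)`. -/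
def normalForm (hq : q ≠ 0) (N : ℕ) :
    ((Fin N → ℤ) →₀ MvPolynomial (Fin N) ℂ) →ₗ[ℂ] DqWeyl q N :=
  Finsupp.lsum ℂ fun α =>
    (LinearMap.mulLeft ℂ (zMonomial q α N)) ∘ₗ (tgAeval hq N).toLinearMap

theorem normalForm_single (hq : q ≠ 0) (α : Fin N → ℤ) (a : MvPolynomial (Fin N) ℂ) :
    normalForm hq N (Finsupp.single α a) = zMonomial q α N * tgAeval hq N a := by
  simp [normalForm]

theorem normalForm_surjective (hq : q ≠ 0) (d : DqWeyl q N) :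
    ∃ f, normalForm hq N f = d := by
  have hclosed : ∀ (e : DqWeyl q N) (v : Fin N → ℤ),
      (∀ α, ∃ a, e * zMonomial q α N = zMonomial q (α + v) N * tgAeval hq N a) →
      ∀ s ∈ LinearMap.range (normalForm hq N), e * s ∈ LinearMap.range (normalForm hq N) := by
    rintro e v he _ ⟨f, rfl⟩
    induction f using Finsupp.induction_linear with
    | zero => simp
    | add f g hf hg => rw [map_add, mul_add]; exact add_mem hf hg
    | single α a =>
      obtain ⟨b, hb⟩ := he α
      exact ⟨Finsupp.single (α + v) (b * a), by
        rw [normalForm_single, normalForm_single, map_mul, ← mul_assoc, ← mul_assoc, hb]⟩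
  have hone : ∀ n, zMonomial q (0 : Fin N → ℤ) n = 1 := by
    intro n
    induction n with
    | zero => rfl
    | succ n ih => simp [zMonomial, ih, zPow]
  refine mem_of_gens (S := LinearMap.range (normalForm hq N))
    ⟨Finsupp.single 0 1, by rw [normalForm_single, hone, map_one, one_mul]⟩
    (fun i => hclosed _ _ (exists_mul_zMonomial (xg_mul_zPow_self hq i) fun j h =>
      xg_mul_zPow_of_ne hq h))
    (fun i => hclosed _ _ (exists_mul_zMonomial (e := -1) (pg_mul_zPow_self hq i) fun j h =>
      pg_mul_zPow_of_ne hq h)) d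

end NormalForm

section Representation

variable {R : Type*} [CommRing R] [Algebra ℂ R] {q : ℂ} {N : ℕ}

variable (R q) in
/-- The operator by which `x_i` acts on functions on `ℤ ^ N`. -/
def xOp (i : Fin N) : Module.End ℂ ((Fin N → ℤ) → R) where
  toFun f m := q ^ prefixSum m i • f (m - Pi.single i 1)
  map_add' f g := by ext m; simp
  map_smul' c f := by ext m; simp [smul_comm c]

variable (q) in
/-- The matrix coefficients of the operator `pOp q u i`. -/
def pCoeff (u : ℕ → R) (i : Fin N) (m : Fin N → ℤ) : R :=
  q ^ (-prefixSum m i) •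
    (q ^ (2 * prefixSum m (i + 1) + 2) • u (i + 1) - q ^ (2 * prefixSum m i) • u i)

theorem pCoeff_add_single_of_lt (hq : q ≠ 0) (u : ℕ → R) {i j : Fin N} (h : i < j)
    (m : Fin N → ℤ) : pCoeff q u j (m + Pi.single i 1) = q • pCoeff q u j m := by
  have h' : (i : ℕ) < j := h
  simp only [pCoeff, prefixSum_add, prefixSum_single, if_pos h', if_pos (Nat.lt_succ_of_lt h'),
    smul_sub, smul_smul, ← zpow_add₀ hq, ← zpow_one_add₀ hq]
  congr 2 <;> congr 1 <;> ring

theorem pCoeff_add_single_of_gt (u : ℕ → R) {i j : Fin N} (h : i < j)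
    (m : Fin N → ℤ) (a : ℤ) : pCoeff q u i (m + Pi.single j a) = pCoeff q u i m := by
  have h1 : ¬ (j : ℕ) < i := by omega
  have h2 : ¬ (j : ℕ) < i + 1 := by omega
  simp only [pCoeff, prefixSum_add, prefixSum_single, if_neg h1, if_neg h2, add_zero]

variable (q) in
/-- The operator by which `∂_i` acts on functions on `ℤ ^ N`. -/
def pOp (u : ℕ → R) (i : Fin N) : Module.End ℂ ((Fin N → ℤ) → R) where
  toFun f m := pCoeff q u i m * f (m + Pi.single i 1)
  map_add' f g := by ext m; simp [mul_add]
  map_smul' c f := by ext m; simp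

variable (q N) in
/-- The operator by which `tg n` acts on functions on `ℤ ^ N`. -/
def tOp (u : ℕ → R) (n : ℕ) : Module.End ℂ ((Fin N → ℤ) → R) where
  toFun f m := (q ^ (2 * prefixSum m n) • u n) * f m
  map_add' f g := by ext m; simp [mul_add]
  map_smul' c f := by ext m; simp

theorem tOp_zero {u : ℕ → R} (hu : u 0 = 1) : tOp q N u 0 = 1 := by
  ext f m
  simp [tOp, hu]

theorem xOp_mul_pOp (hq : q ≠ 0) (u : ℕ → R) (i : Fin N) :
    xOp R q i * pOp q u i = tOp q N u (i + 1) - tOp q N u i := by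
  ext f m
  simp only [xOp, pOp, pCoeff, tOp, Module.End.mul_apply, LinearMap.coe_mk, AddHom.coe_mk,
    LinearMap.sub_apply, Pi.sub_apply, prefixSum_sub, prefixSum_single, sub_add_cancel,
    lt_irrefl, if_false, sub_zero, Nat.lt_succ_self, if_true, mul_sub, mul_one, smul_mul_assoc,
    sub_mul, smul_sub, smul_smul, ← zpow_add₀ hq, add_neg_cancel_left]

theorem pOp_mul_xOp (hq : q ≠ 0) (u : ℕ → R) (i : Fin N) :
    pOp q u i * xOp R q i = q ^ 2 • tOp q N u (i + 1) - tOp q N u i := by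
  ext f m
  simp only [xOp, pOp, pCoeff, tOp, Module.End.mul_apply, LinearMap.coe_mk, AddHom.coe_mk,
    LinearMap.sub_apply, Pi.sub_apply, prefixSum_add, prefixSum_single, add_sub_cancel_right,
    lt_irrefl, if_false, add_zero, smul_mul_assoc, mul_smul_comm, LinearMap.smul_apply,
    Pi.smul_apply, sub_mul, smul_sub, smul_smul, ← zpow_add₀ hq, ← zpow_natCast]
  congr 2 <;> congr 1 <;> push_cast <;> ring

theorem one_add_prefixSum_xOp_mul_pOp (hq : q ≠ 0) {u : ℕ → R} (hu : u 0 = 1) (n : ℕ)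
    (hn : n ≤ N) :
    1 + prefixSum (fun j => xOp R q j * pOp q u j) n = tOp q N u n := by
  induction n with
  | zero => simp [tOp_zero hu]
  | succ n ih =>
    have := prefixSum_succ (fun j => xOp R q j * pOp q u j) ⟨n, hn⟩
    simp only at this
    rw [this, ← add_assoc, ih (by omega), xOp_mul_pOp hq, add_sub_cancel]

/-- The action of the generators on functions on `ℤ ^ N`. -/
def genOp (q : ℂ) (u : ℕ → R) : DGen N → Module.End ℂ ((Fin N → ℤ) → R)
  | .x i => xOp R q i
  | .p i => pOp q u i

theorem genOp_rel (hq : q ≠ 0) {u : ℕ → R} (hu : u 0 = 1) {a b : FreeAlgebra ℂ (DGen N)}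
    (h : DqRel q N a b) :
    FreeAlgebra.lift ℂ (genOp q u) a = FreeAlgebra.lift ℂ (genOp q u) b := by
  induction h with
  | @xx i j h =>
    have h1 : (i : ℕ) < j := h
    have h2 : ¬ (j : ℕ) < i := by omega
    simp only [Xf, map_mul, map_smul, FreeAlgebra.lift_ι_apply, genOp]
    ext f m
    simp only [xOp, Module.End.mul_apply, LinearMap.coe_mk, AddHom.coe_mk, LinearMap.smul_apply,
      Pi.smul_apply, prefixSum_sub, prefixSum_single, if_pos h1, if_neg h2, smul_smul,
      ← zpow_add₀ hq, ← zpow_one_add₀ hq, sub_right_comm m]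
    congr 2
    ring
  | @pp i j h =>
    simp only [Pf, map_mul, map_smul, FreeAlgebra.lift_ι_apply, genOp]
    ext f m
    simp only [pOp, Module.End.mul_apply, LinearMap.coe_mk, AddHom.coe_mk, LinearMap.smul_apply,
      Pi.smul_apply, pCoeff_add_single_of_lt hq u h, pCoeff_add_single_of_gt u h,
      add_right_comm m, smul_mul_assoc, mul_smul_comm, smul_smul, inv_mul_cancel₀ hq, one_smul]
    ring
  | @px i j h =>
    simp only [Xf, Pf, map_mul, map_smul, FreeAlgebra.lift_ι_apply, genOp]
    ext f m
    simp only [xOp, pOp, Module.End.mul_apply, LinearMap.coe_mk, AddHom.coe_mk,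
      LinearMap.smul_apply, Pi.smul_apply, sub_add_eq_add_sub, mul_smul_comm, smul_smul]
    rcases h.lt_or_gt with h | h
    · have h1 : (j : ℕ) < i := h
      rw [sub_eq_add_neg m, ← Pi.single_neg, pCoeff_add_single_of_gt u h, prefixSum_add,
        prefixSum_single, if_pos h1, ← zpow_one_add₀ hq, add_comm (1 : ℤ)]
    · have h1 : ¬ (j : ℕ) < i := by omega
      have hc := pCoeff_add_single_of_lt hq u h (m - Pi.single i 1)
      rw [sub_add_cancel] at hc
      rw [hc, prefixSum_add, prefixSum_single, if_neg h1, add_zero, smul_mul_assoc, smul_smul,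
        mul_comm]
  | pxi i =>
    have ht := one_add_prefixSum_xOp_mul_pOp hq hu i i.isLt.le
    simp only [Xf, Pf, map_mul, map_smul, map_add, map_one, map_sum, FreeAlgebra.lift_ι_apply,
      genOp]
    change _ = _ + (q ^ 2 - 1) • (1 + prefixSum (fun j => xOp R q j * pOp q u j) i)
    rw [ht, pOp_mul_xOp hq, xOp_mul_pOp hq]
    module

/-- The representation of the quantum Weyl algebra on functions on `ℤ ^ N`. -/
def funRep (hq : q ≠ 0) {u : ℕ → R} (hu : u 0 = 1) :
    DqWeyl q N →ₐ[ℂ] Module.End ℂ ((Fin N → ℤ) → R) :=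
  RingQuot.liftAlgHom ℂ ⟨FreeAlgebra.lift ℂ (genOp q u), fun _ _ h => genOp_rel hq hu h⟩

theorem funRep_xg (hq : q ≠ 0) {u : ℕ → R} (hu : u 0 = 1) (i : Fin N) :
    funRep hq hu (xg q N i) = xOp R q i := by
  simp [funRep, xg, Xf, genOp]

theorem funRep_pg (hq : q ≠ 0) {u : ℕ → R} (hu : u 0 = 1) (i : Fin N) :
    funRep hq hu (pg q N i) = pOp q u i := by
  simp [funRep, pg, Pf, genOp]

theorem funRep_tg (hq : q ≠ 0) {u : ℕ → R} (hu : u 0 = 1) (n : ℕ) (hn : n ≤ N) :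
    funRep hq hu (tg q N n) = tOp q N u n := by
  rw [← one_add_prefixSum_xOp_mul_pOp hq hu n hn, tg, map_add, map_one, prefixSum, map_sum,
    prefixSum]
  simp [funRep_xg, funRep_pg]

end Representation

section Center

open MvPolynomial

/-- The algebra endomorphism rescaling the variables of a polynomial ring. -/
def scaleVars {σ : Type*} (w : σ → ℂ) : MvPolynomial σ ℂ →ₐ[ℂ] MvPolynomial σ ℂ :=
  aeval fun i => w i • X i

theorem scaleVars_one {σ : Type*} (p : MvPolynomial σ ℂ) : scaleVars (fun _ => 1) p = p := by
  simp [scaleVars]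

theorem coeff_scaleVars {σ : Type*} [Fintype σ] (w : σ → ℂ) (p : MvPolynomial σ ℂ) (n : σ →₀ ℕ) :
    coeff n (scaleVars w p) = (∏ i, w i ^ n i) * coeff n p := by
  classical
  induction p using MvPolynomial.induction_on' with
  | monomial d a =>
    have : scaleVars w (monomial d a) = monomial d ((∏ i, w i ^ d i) * a) := by
      rw [scaleVars, aeval_monomial, Finsupp.prod_fintype _ _ (by simp)]
      simp only [smul_eq_C_mul, mul_pow, Finset.prod_mul_distrib]
      rw [monomial_eq (s := d), Finsupp.prod_fintype _ _ (by simp), map_mul, map_prod,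
        algebraMap_eq]
      simp only [map_pow]
      ring
    rw [this, coeff_monomial, coeff_monomial]
    split_ifs with h
    · rw [h]
    · simp
  | add p r hp hr => rw [map_add, coeff_add, coeff_add, hp, hr, mul_add]

theorem mem_adjoin_X_pow {σ : Type*} {l : ℕ} {p : MvPolynomial σ ℂ}
    (h : ∀ n, coeff n p ≠ 0 → ∀ i, l ∣ n i) :
    p ∈ Algebra.adjoin ℂ (Set.range fun i : σ => (X i : MvPolynomial σ ℂ) ^ l) := by
  rw [p.as_sum]
  refine sum_mem fun n hn => ?_
  rw [monomial_eq, ← algebraMap_eq]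
  refine mul_mem (Subalgebra.algebraMap_mem _ _) (prod_mem fun i _ => ?_)
  obtain ⟨k, hk⟩ := h n (mem_support_iff.1 hn) i
  simp only [hk, pow_mul]
  exact pow_mem (Algebra.subset_adjoin (Set.mem_range_self i)) k

/-- `T` shifts functions by `α` and multiplies them by a nowhere vanishing function. -/
def IsWeightedShift {G R : Type*} [AddCommGroup G] [CommRing R] [Algebra ℂ R]
    (T : Module.End ℂ (G → R)) (α : G) : Prop :=
  ∃ g : G → R, (∀ m, g m ≠ 0) ∧ ∀ f m, T f m = g m * f (m - α)

namespace IsWeightedShift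

variable {G R : Type*} [AddCommGroup G] [CommRing R] [IsDomain R] [Algebra ℂ R]
  {T U : Module.End ℂ (G → R)} {α β : G}

theorem one : IsWeightedShift (1 : Module.End ℂ (G → R)) 0 :=
  ⟨1, by simp, by simp⟩

theorem mul (hT : IsWeightedShift T α) (hU : IsWeightedShift U β) :
    IsWeightedShift (T * U) (α + β) := by
  obtain ⟨g, hg, hT⟩ := hT
  obtain ⟨g', hg', hU⟩ := hU
  refine ⟨fun m => g m * g' (m - α), fun m => mul_ne_zero (hg _) (hg' _), fun f m => ?_⟩
  rw [Module.End.mul_apply, hT, hU, mul_assoc, sub_sub]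

theorem pow (hT : IsWeightedShift T α) (n : ℕ) : IsWeightedShift (T ^ n) (n • α) := by
  induction n with
  | zero => simpa using one
  | succ n ih => rw [pow_succ, succ_nsmul]; exact ih.mul hT

end IsWeightedShift

variable {q : ℂ} {N : ℕ}

/-- The variables of the polynomial ring, preceded by `1`. -/
def oneX (N : ℕ) : ℕ → MvPolynomial (Fin N) ℂ
  | 0 => 1
  | n + 1 => if h : n < N then X ⟨n, h⟩ else 0

theorem oneX_succ (i : Fin N) : oneX N (i + 1) = X i := by
  simp [oneX]

theorem oneX_zero : oneX N 0 = 1 := rfl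

theorem oneX_ne_zero {n : ℕ} (hn : n ≤ N) : oneX N n ≠ 0 := by
  cases n with
  | zero => exact one_ne_zero
  | succ n => rw [oneX_succ ⟨n, hn⟩]; exact X_ne_zero _

theorem pCoeff_oneX_ne_zero (hq : q ≠ 0) (i : Fin N) (m : Fin N → ℤ) :
    pCoeff q (oneX N) i m ≠ 0 := by
  have hc : coeff (Finsupp.single i 1) (oneX N i) = 0 := by
    obtain ⟨k, hk⟩ := i
    cases k with
    | zero => simp [oneX, coeff_one, eq_comm]
    | succ k =>
      rw [oneX_succ ⟨k, by omega⟩, coeff_X, if_neg]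
      simp [Finsupp.single_left_inj]
  intro h
  have := congrArg (coeff (Finsupp.single i 1)) h
  rw [pCoeff, coeff_smul, coeff_sub, coeff_smul, coeff_smul, hc, oneX_succ, coeff_X] at this
  simp [hq, zpow_ne_zero] at this

/-- The representation of the quantum Weyl algebra with generic parameters. -/
abbrev genericRep (hq : q ≠ 0) (N : ℕ) :
    DqWeyl q N →ₐ[ℂ] Module.End ℂ ((Fin N → ℤ) → MvPolynomial (Fin N) ℂ) :=
  funRep hq oneX_zero

theorem isWeightedShift_xg (hq : q ≠ 0) (i : Fin N) :
    IsWeightedShift (genericRep hq N (xg q N i)) (Pi.single i 1) := by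
  refine ⟨fun m => C (q ^ prefixSum m i), fun m => ?_, fun f m => ?_⟩
  · simp [zpow_ne_zero, hq]
  · rw [genericRep, funRep_xg, ← smul_eq_C_mul]
    rfl

theorem isWeightedShift_pg (hq : q ≠ 0) (i : Fin N) :
    IsWeightedShift (genericRep hq N (pg q N i)) (-Pi.single i 1) := by
  refine ⟨pCoeff q (oneX N) i, pCoeff_oneX_ne_zero hq i, fun f m => ?_⟩
  rw [genericRep, funRep_pg, sub_neg_eq_add]
  rfl

theorem isWeightedShift_zPow (hq : q ≠ 0) (i : Fin N) (k : ℤ) :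
    IsWeightedShift (genericRep hq N (zPow q N i k)) (Pi.single i k) := by
  cases k with
  | ofNat n =>
    have := (isWeightedShift_xg hq i).pow n
    rw [← map_pow, ← Pi.single_smul, nsmul_one] at this
    exact this
  | negSucc n =>
    have := (isWeightedShift_pg hq i).pow (n + 1)
    rw [← map_pow, smul_neg, ← Pi.single_smul, nsmul_one, ← Pi.single_neg] at this
    exact this

theorem isWeightedShift_zMonomial (hq : q ≠ 0) (α : Fin N → ℤ) :
    IsWeightedShift (genericRep hq N (zMonomial q α N)) α := by
  have key : ∀ n, IsWeightedShift (genericRep hq N (zMonomial q α n))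
      (fun j => if (j : ℕ) < n then α j else 0) := by
    intro n
    induction n with
    | zero =>
      simp only [Nat.not_lt_zero, if_false]
      rw [zMonomial, map_one]
      exact IsWeightedShift.one
    | succ n ih =>
      rw [zMonomial, map_mul]
      split_ifs with h
      · convert ih.mul (isWeightedShift_zPow hq ⟨n, h⟩ (α ⟨n, h⟩)) using 1
        ext j
        rcases lt_trichotomy (j : ℕ) n with hj | rfl | hj
        · have : j ≠ ⟨n, h⟩ := by rintro rfl; exact lt_irrefl _ hj
          simp [hj, hj.trans (Nat.lt_succ_self n), this]
        · simp
        · have : j ≠ ⟨n, h⟩ := by rintro rfl; exact lt_irrefl _ hj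
          simp [hj.not_gt, Nat.not_lt.2 (Nat.succ_le_of_lt hj), this]
      · rw [map_one, mul_one]
        convert ih using 2 with j
        have := j.isLt
        rw [if_pos (by omega), if_pos (by omega)]
  convert key N using 1
  ext j
  simp

theorem genericRep_tgAeval (hq : q ≠ 0) (a : MvPolynomial (Fin N) ℂ)
    (f : (Fin N → ℤ) → MvPolynomial (Fin N) ℂ) (m : Fin N → ℤ) :
    genericRep hq N (tgAeval hq N a) f m =
      scaleVars (fun i : Fin N => q ^ (2 * prefixSum m (i + 1))) a * f m := by
  induction a using MvPolynomial.induction_on generalizing f with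
  | C r =>
    rw [← algebraMap_eq, AlgHom.commutes, AlgHom.commutes, AlgHom.commutes, algebraMap_eq,
      ← smul_eq_C_mul]
    rfl
  | add a b ha hb =>
    rw [map_add, map_add, map_add, LinearMap.add_apply, Pi.add_apply, ha, hb, add_mul]
  | mul_X a i ha =>
    rw [map_mul, map_mul, Module.End.mul_apply, ha, map_mul, tgAeval_X, genericRep,
      funRep_tg _ _ _ i.isLt, mul_assoc]
    simp [scaleVars, tOp, oneX_succ]

/-- The matrix coefficients of an element in normal form in the generic representation. -/
theorem genericRep_normalForm_single (hq : q ≠ 0)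
    {g : (Fin N → ℤ) → (Fin N → ℤ) → MvPolynomial (Fin N) ℂ}
    (hg : ∀ α f m, genericRep hq N (zMonomial q α N) f m = g α m * f (m - α))
    (F : (Fin N → ℤ) →₀ MvPolynomial (Fin N) ℂ) (α n : Fin N → ℤ) (b : MvPolynomial (Fin N) ℂ) :
    genericRep hq N (normalForm hq N F) (Pi.single n b) (α + n) =
      g α (α + n) * scaleVars (fun i : Fin N => q ^ (2 * prefixSum n (i + 1))) (F α) * b := by
  induction F using Finsupp.induction_linear with
  | zero => simp
  | add F F' hF hF' =>
    rw [map_add, map_add, LinearMap.add_apply, Pi.add_apply, hF, hF', Finsupp.add_apply, map_add,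
      mul_add, add_mul]
  | single β a =>
    rw [normalForm_single, map_mul, Module.End.mul_apply, hg, genericRep_tgAeval]
    by_cases h : β = α
    · subst h
      simp [mul_assoc]
    · have h' : α + n - β ≠ n := fun h' => h (by
        rw [sub_eq_iff_eq_add, add_comm n] at h'
        exact (add_right_cancel h').symm)
      simp [h, h']

end Center

section Main

open MvPolynomial

variable {q : ℂ} {N l : ℕ}

variable (q N l) in
/-- The subalgebra generated by the `l`-th powers of the generators. -/
abbrev powSubalgebra : Subalgebra ℂ (DqWeyl q N) :=
  Algebra.adjoin ℂ
    ((Set.range fun i : Fin N => xg q N i ^ l) ∪ (Set.range fun i : Fin N => pg q N i ^ l))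

theorem xg_pow_mem (i : Fin N) : xg q N i ^ l ∈ powSubalgebra q N l :=
  Algebra.subset_adjoin (.inl ⟨i, rfl⟩)

theorem pg_pow_mem (i : Fin N) : pg q N i ^ l ∈ powSubalgebra q N l :=
  Algebra.subset_adjoin (.inr ⟨i, rfl⟩)

theorem powSubalgebra_le_center (hl : 0 < l) (hql : q ^ l = 1) :
    powSubalgebra q N l ≤ Subalgebra.center ℂ (DqWeyl q N) := by
  refine Algebra.adjoin_le ?_
  rintro _ (⟨i, rfl⟩ | ⟨i, rfl⟩)
  · exact xg_pow_mem_center hl hql i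
  · exact pg_pow_mem_center hl hql i

theorem tg_pow_mem (hodd : Odd l) (hql : IsPrimitiveRoot q l) (n : ℕ) :
    tg q N n ^ l ∈ powSubalgebra q N l := by
  induction n with
  | zero => simp
  | succ n ih =>
    by_cases h : n < N
    · have := xg_pow_mul_pg_pow (N := N) (hql.ne_zero hodd.pos.ne') hodd hql ⟨n, h⟩
      rw [eq_comm, sub_eq_iff_eq_add] at this
      rw [this]
      exact add_mem (mul_mem (xg_pow_mem _) (pg_pow_mem _)) ih
    · rwa [tg_succ_of_le (not_lt.1 h)]

theorem zMonomial_mem {α : Fin N → ℤ} (h : ∀ i, (l : ℤ) ∣ α i) (n : ℕ) :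
    zMonomial q α n ∈ powSubalgebra q N l := by
  induction n with
  | zero => exact one_mem _
  | succ n ih =>
    rw [zMonomial]
    refine mul_mem ih ?_
    split_ifs with hn
    · obtain ⟨k, hk⟩ := h ⟨n, hn⟩
      rw [hk]
      obtain ⟨k, rfl | rfl⟩ := k.eq_nat_or_neg
      · rw [← Nat.cast_mul]
        change xg q N _ ^ (l * k) ∈ _
        rw [pow_mul]
        exact pow_mem (xg_pow_mem _) k
      · rw [mul_neg, ← Nat.cast_mul, zPow_neg, pow_mul]
        exact pow_mem (pg_pow_mem _) k
    · exact one_mem _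

theorem tgAeval_mem (hodd : Odd l) (hql : IsPrimitiveRoot q l) (hq : q ≠ 0)
    {a : MvPolynomial (Fin N) ℂ} (h : ∀ n, coeff n a ≠ 0 → ∀ i, l ∣ n i) :
    tgAeval hq N a ∈ powSubalgebra q N l := by
  have hmem := Subalgebra.mem_map.2 ⟨a, mem_adjoin_X_pow h, (rfl : tgAeval hq N a = _)⟩
  rw [AlgHom.map_adjoin] at hmem
  refine Algebra.adjoin_le ?_ hmem
  rintro _ ⟨_, ⟨i, rfl⟩, rfl⟩
  rw [SetLike.mem_coe]
  simpa using tg_pow_mem hodd hql (i + 1)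

theorem zpow_sum₀ {ι K : Type*} [Field K] {a : K} (ha : a ≠ 0) (s : Finset ι) (f : ι → ℤ) :
    a ^ ∑ i ∈ s, f i = ∏ i ∈ s, a ^ f i := by
  classical
  induction s using Finset.induction_on with
  | empty => simp
  | insert i s hi ih => rw [Finset.sum_insert hi, Finset.prod_insert hi, zpow_add₀ ha, ih]

theorem dvd_of_zpow_two_mul_eq_one (hodd : Odd l) (hql : IsPrimitiveRoot q l) {k : ℤ}
    (h : q ^ (2 * k) = 1) : (l : ℤ) ∣ k := by
  rw [hql.zpow_eq_one_iff_dvd] at h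
  exact (Nat.isCoprime_iff_coprime.2 hodd.coprime_two_right).dvd_of_dvd_mul_left h

theorem dvd_of_dvd_prefixSum {a : ℤ} {α : Fin N → ℤ} (h : ∀ n ≤ N, a ∣ prefixSum α n)
    (i : Fin N) : a ∣ α i := by
  have := dvd_sub (h (i + 1) i.isLt) (h i i.isLt.le)
  rwa [prefixSum_succ, add_sub_cancel_left] at this

theorem dvd_of_dvd_suffixSum {a : ℤ} {α : Fin N → ℤ}
    (h : ∀ j : Fin N, a ∣ ∑ i ∈ Finset.univ.filter (fun i : Fin N => j ≤ i), α i)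
    (i : Fin N) : a ∣ α i := by
  have htot : a ∣ ∑ i, α i := by
    have hN := i.pos
    simpa [Fin.le_def] using h ⟨0, hN⟩
  refine dvd_of_dvd_prefixSum (fun n hn => ?_) i
  rcases hn.eq_or_lt with rfl | hn
  · simpa [prefixSum] using htot
  · rw [← Finset.sum_filter_add_sum_filter_not _ (fun j : Fin N => (j : ℕ) < n)] at htot
    refine (dvd_add_left ?_).1 htot
    simpa [Fin.le_def] using h ⟨n, hn⟩

theorem xOp_single (R : Type*) [CommRing R] [Algebra ℂ R] (i : Fin N) :
    xOp R q i (Pi.single 0 1) = Pi.single (Pi.single i 1) 1 := by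
  ext m
  by_cases h : m = Pi.single i 1
  · subst h
    simp [xOp, prefixSum_single]
  · have h' : m - Pi.single i 1 ≠ 0 := sub_ne_zero.2 h
    simp [xOp, h, h']

theorem tOp_single {R : Type*} [CommRing R] [Algebra ℂ R] (u : ℕ → R) (n : ℕ) :
    tOp q N u n (Pi.single 0 1) = Pi.single 0 (u n) := by
  ext m
  by_cases h : m = 0
  · subst h
    simp [tOp, prefixSum]
  · simp [tOp, h]

theorem zpow_prefixSum_eq_one_of_mem_center (hq : q ≠ 0)
    {F : (Fin N → ℤ) →₀ MvPolynomial (Fin N) ℂ}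
    (hF : normalForm hq N F ∈ Subalgebra.center ℂ (DqWeyl q N)) {α : Fin N → ℤ} (hα : F α ≠ 0)
    {n : ℕ} (hn : n ≤ N) : q ^ (2 * prefixSum α n) = 1 := by
  choose g hg0 hg using isWeightedShift_zMonomial (N := N) hq
  have hcomm := Subalgebra.mem_center_iff.1 hF (tg q N n)
  have hZ := genericRep_normalForm_single hq hg F α 0
  simp only [prefixSum, Pi.zero_apply, Finset.sum_const_zero, mul_zero, zpow_zero, scaleVars_one,
    add_zero] at hZ
  have h := congrArg (fun T => genericRep hq N T (Pi.single 0 1) α) hcomm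
  simp only [map_mul, Module.End.mul_apply] at h
  rw [genericRep, funRep_tg _ _ _ hn, tOp_single, hZ] at h
  change (q ^ (2 * prefixSum α n) • oneX N n) * _ = _ at h
  rw [hZ, mul_one, smul_mul_assoc, mul_comm (oneX N n)] at h
  have hne : g α α * F α * oneX N n ≠ 0 :=
    mul_ne_zero (mul_ne_zero (hg0 _ _) hα) (oneX_ne_zero hn)
  have : (q ^ (2 * prefixSum α n) - 1) • (g α α * F α * oneX N n) = 0 := by
    rw [sub_smul, one_smul, h, sub_self]
  exact sub_eq_zero.1 ((smul_eq_zero.1 this).resolve_right hne)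

theorem scaleVars_eq_of_mem_center (hq : q ≠ 0) {F : (Fin N → ℤ) →₀ MvPolynomial (Fin N) ℂ}
    (hF : normalForm hq N F ∈ Subalgebra.center ℂ (DqWeyl q N)) {α : Fin N → ℤ}
    (hα : zMonomial q α N ∈ Subalgebra.center ℂ (DqWeyl q N)) (j : Fin N) :
    scaleVars (fun i : Fin N => q ^ (2 * prefixSum (Pi.single j 1 : Fin N → ℤ) (i + 1))) (F α) =
      F α := by
  choose g hg0 hg using isWeightedShift_zMonomial (N := N) hq
  have hx : ∀ {z : DqWeyl q N}, z ∈ Subalgebra.center ℂ (DqWeyl q N) →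
      genericRep hq N z (Pi.single (Pi.single j 1) 1) (α + Pi.single j 1) =
        q ^ prefixSum (α + Pi.single j 1) j • genericRep hq N z (Pi.single 0 1) α := by
    intro z hz
    have h := congrArg (fun T => genericRep hq N T (Pi.single 0 1) (α + Pi.single j 1))
      (Subalgebra.mem_center_iff.1 hz (xg q N j))
    simp only [map_mul, Module.End.mul_apply] at h
    rw [genericRep, funRep_xg, xOp_single] at h
    rw [← h]
    simp [xOp]
  have hZ := hx hF
  have hW := hx hα
  have h0 := genericRep_normalForm_single hq hg F α 0 1
  simp only [prefixSum, Pi.zero_apply, Finset.sum_const_zero, mul_zero, zpow_zero, scaleVars_one,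
    add_zero, mul_one] at h0
  rw [genericRep_normalForm_single hq hg, h0, mul_one, ← smul_mul_assoc] at hZ
  rw [hg, hg, add_sub_cancel_left, sub_self, Pi.single_eq_same, Pi.single_eq_same, mul_one,
    mul_one] at hW
  rw [← hW] at hZ
  exact mul_left_cancel₀ (hg0 _ _) hZ

theorem center_le_powSubalgebra (hodd : Odd l) (hql : IsPrimitiveRoot q l) :
    Subalgebra.center ℂ (DqWeyl q N) ≤ powSubalgebra q N l := by
  have hq := hql.ne_zero hodd.pos.ne'
  intro z hz
  obtain ⟨F, rfl⟩ := normalForm_surjective hq z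
  rw [normalForm, Finsupp.lsum_apply, Finsupp.sum]
  refine sum_mem fun α hα => ?_
  change zMonomial q α N * tgAeval hq N (F α) ∈ _
  have hW : zMonomial q α N ∈ powSubalgebra q N l :=
    zMonomial_mem (dvd_of_dvd_prefixSum fun n hn => dvd_of_zpow_two_mul_eq_one hodd hql
      (zpow_prefixSum_eq_one_of_mem_center hq hz (Finsupp.mem_support_iff.1 hα) hn)) N
  refine mul_mem hW (tgAeval_mem hodd hql hq fun n hn i => ?_)
  have hWc := powSubalgebra_le_center hodd.pos hql.pow_eq_one hW
  rw [← Int.natCast_dvd_natCast]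
  refine dvd_of_dvd_suffixSum (α := fun i => (n i : ℤ)) (fun j => ?_) i
  refine dvd_of_zpow_two_mul_eq_one hodd hql ?_
  have h := congrArg (coeff n) (scaleVars_eq_of_mem_center hq hz hWc j)
  rw [coeff_scaleVars, mul_eq_right₀ hn] at h
  rw [← h, Finset.mul_sum, Finset.sum_filter, zpow_sum₀ hq]
  refine Finset.prod_congr rfl fun i _ => ?_
  rw [prefixSum_single, ← zpow_natCast, ← zpow_mul]
  congr 1
  have : j ≤ i ↔ (j : ℕ) < i + 1 := by rw [Fin.le_def, Nat.lt_succ_iff]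
  simp only [this]
  split_ifs <;> simp

/-- Every point with nonzero `x`-coordinates is the joint eigenvalue of the `l`-th powers of the
generators on some vector of some representation. -/
theorem exists_eigenvector (hodd : Odd l) (hql : IsPrimitiveRoot q l) (c : Fin N ⊕ Fin N → ℂ)
    (hc : ∀ i, c (.inl i) ≠ 0) :
    ∃ (ρ : DqWeyl q N →ₐ[ℂ] Module.End ℂ ((Fin N → ℤ) → ℂ)) (f : (Fin N → ℤ) → ℂ), f ≠ 0 ∧
      ∀ s, ρ (Sum.elim (fun i => xg q N i ^ l) (fun i => pg q N i ^ l) s) f = c s • f := by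
  have hq := hql.ne_zero hodd.pos.ne'
  choose r hr using fun i => IsAlgClosed.exists_pow_nat_eq (c (.inl i)) hodd.pos
  have hr0 : ∀ i, r i ≠ 0 := fun i h => hc i (by rw [← hr, h, zero_pow hodd.pos.ne'])
  set v : ℕ → ℂ := fun n => 1 + prefixSum (fun i => c (.inl i) * c (.inr i)) n with hv
  obtain ⟨u, hu0, hu⟩ : ∃ u : ℕ → ℂ, u 0 = 1 ∧ ∀ n, u n ^ l = v n := by
    choose u hu using fun n => IsAlgClosed.exists_pow_nat_eq (v n) hodd.pos
    refine ⟨Function.update u 0 1, by simp, fun n => ?_⟩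
    cases n with
    | zero => simp [hv]
    | succ n => simp [hu]
  let f : (Fin N → ℤ) → ℂ := fun m => ∏ i, r i ^ (-m i)
  have hroot : ∀ k : ℤ, (q ^ k) ^ l = 1 := fun k => by
    rw [← zpow_natCast, zpow_comm, zpow_natCast, hql.pow_eq_one, one_zpow]
  have hx : ∀ i, (xOp ℂ q i ^ l) f = c (.inl i) • f := by
    intro i
    have hf : ∀ m, f (m - Pi.single i 1) = r i * f m := by
      intro m
      simp only [f, Pi.sub_apply, neg_sub, sub_eq_add_neg _ (m _), zpow_add₀ (hr0 _),
        Finset.prod_mul_distrib]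
      congr 1
      rw [Finset.prod_eq_single i (fun j _ h => by simp [h]) (by simp)]
      simp
    have key : ∀ n m, (xOp ℂ q i ^ n) f m = (q ^ prefixSum m i * r i) ^ n * f m := by
      intro n
      induction n with
      | zero => simp
      | succ n ih =>
        intro m
        rw [pow_succ', Module.End.mul_apply]
        change q ^ prefixSum m i • (xOp ℂ q i ^ n) f (m - Pi.single i 1) = _
        rw [ih, hf, prefixSum_sub, prefixSum_single, if_neg (lt_irrefl _), sub_zero, smul_eq_mul]
        ring
    ext m
    rw [key, mul_pow, hroot, hr, one_mul]
    rfl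
  have ht : ∀ n, (tOp q N u n ^ l) f = v n • f := by
    intro n
    have key : ∀ k m, (tOp q N u n ^ k) f m = (q ^ (2 * prefixSum m n) * u n) ^ k * f m := by
      intro k
      induction k with
      | zero => simp
      | succ k ih =>
        intro m
        rw [pow_succ', Module.End.mul_apply]
        change (q ^ (2 * prefixSum m n) • u n) * (tOp q N u n ^ k) f m = _
        rw [ih, smul_eq_mul]
        ring
    ext m
    rw [key, mul_pow, hroot, hu, one_mul]
    rfl
  refine ⟨funRep hq hu0, f, fun h => ?_, ?_⟩
  · have := congrFun h 0
    simp [f] at this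
  · have hX : ∀ i, funRep hq hu0 (xg q N i ^ l) f = c (.inl i) • f := fun i => by
      rw [map_pow, funRep_xg, hx]
    rintro (i | i)
    · exact hX i
    · have h := congrArg (fun T => funRep hq hu0 T f) (xg_pow_mul_pg_pow hq hodd hql i)
      have hcomm := Subalgebra.mem_center_iff.1
        (xg_pow_mem_center hodd.pos hql.pow_eq_one i) (pg q N i ^ l)
      simp only [← hcomm] at h
      rw [map_mul, Module.End.mul_apply, hX, map_smul, map_sub, LinearMap.sub_apply,
        map_pow _ (tg _ _ _), map_pow _ (tg _ _ _), funRep_tg _ _ _ i.isLt,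
        funRep_tg _ _ _ i.isLt.le, ht, ht, ← sub_smul] at h
      simp only [hv, prefixSum_succ, add_sub_add_left_eq_sub, add_sub_cancel_left, mul_smul] at h
      exact smul_right_injective _ (hc i) h

theorem commute_pow_generators (hl : 0 < l) (hql : q ^ l = 1) (s t : Fin N ⊕ Fin N) :
    Commute (Sum.elim (fun i => xg q N i ^ l) (fun i => pg q N i ^ l) s)
      (Sum.elim (fun i => xg q N i ^ l) (fun i => pg q N i ^ l) t) := by
  have h : Sum.elim (fun i => xg q N i ^ l) (fun i => pg q N i ^ l) t ∈
      Subalgebra.center ℂ (DqWeyl q N) := by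
    rcases t with i | i
    · exact xg_pow_mem_center hl hql i
    · exact pg_pow_mem_center hl hql i
  exact Subalgebra.mem_center_iff.1 h _

theorem commAeval_pow_generators_injective (hodd : Odd l) (hql : IsPrimitiveRoot q l) :
    Function.Injective (commAeval _
      (commute_pow_generators (q := q) (N := N) hodd.pos hql.pow_eq_one)) := by
  rw [injective_iff_map_eq_zero]
  intro F hF
  by_contra hne
  have hne' : F * ∏ i : Fin N, X (.inl i) ≠ 0 :=
    mul_ne_zero hne (Finset.prod_ne_zero_iff.2 fun i _ => X_ne_zero _)
  obtain ⟨c, hc⟩ : ∃ c, eval c (F * ∏ i : Fin N, X (.inl i)) ≠ 0 := by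
    by_contra! h
    exact hne' (MvPolynomial.funext fun c => by rw [h, map_zero])
  rw [map_mul, map_prod, mul_ne_zero_iff, Finset.prod_ne_zero_iff] at hc
  obtain ⟨ρ, f, hf, hρ⟩ := exists_eigenvector hodd hql c fun i => by
    simpa using hc.2 i (Finset.mem_univ i)
  have key : ∀ G, ρ (commAeval _
      (commute_pow_generators (q := q) (N := N) hodd.pos hql.pow_eq_one) G) f =
      eval c G • f := by
    intro G
    induction G using MvPolynomial.induction_on with
    | C a =>
      rw [← algebraMap_eq, AlgHom.commutes, AlgHom.commutes, algebraMap_eq, eval_C]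
      rfl
    | add a b ha hb => simp only [map_add, LinearMap.add_apply, ha, hb, add_smul]
    | mul_X a s ha =>
      rw [map_mul, map_mul, Module.End.mul_apply, commAeval_X, hρ, map_smul, ha, map_mul, eval_X,
        mul_comm, mul_smul]
  have := key F
  rw [hF, map_zero, LinearMap.zero_apply, eq_comm, smul_eq_zero] at this
  exact this.elim hc.1 hf

end Main

/-- at a primitive ℓ-th root of unity q (ℓ > 1 odd), the center of
D_q(ℂ^N) is exactly the subalgebra generated by x_1^ℓ,…,x_N^ℓ,∂_1^ℓ,…,∂_N^ℓ,
and this subalgebra is isomorphic to a polynomial algebra in 2N variables. -/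
theorem stmt_6 (q : ℂ) (l : ℕ) (hl : 1 < l) (hodd : Odd l) (hq : IsPrimitiveRoot q l)
    (N : ℕ) :
    Subalgebra.center ℂ (DqWeyl q N) =
      Algebra.adjoin ℂ
        ((Set.range fun i : Fin N => xg q N i ^ l) ∪
         (Set.range fun i : Fin N => pg q N i ^ l)) ∧
    Nonempty
      ((Algebra.adjoin ℂ
        ((Set.range fun i : Fin N => xg q N i ^ l) ∪
         (Set.range fun i : Fin N => pg q N i ^ l))) ≃ₐ[ℂ]
        MvPolynomial (Fin N ⊕ Fin N) ℂ) := by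
  refine ⟨le_antisymm (center_le_powSubalgebra hodd hq)
    (powSubalgebra_le_center hodd.pos hq.pow_eq_one), ?_⟩
  rw [← Set.Sum.elim_range, ← commAeval_range _ (commute_pow_generators hodd.pos hq.pow_eq_one)]
  exact ⟨(AlgEquiv.ofInjective _ (commAeval_pow_generators_injective hodd hq)).symm⟩
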